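/- Let φ solve −Δφ + (1/2π)(ln|·| ∗ |φ|^2)φ = 0 with Λ_0 = ∫|φ|^2 finite. Then T(φ) = Λ_0^2/(8π), V(φ) = −T(φ), and E(φ) = T(φ) + V(φ)/2 = Λ_0^2/(16π). -/

import Mathlib

open MeasureTheory

noncomputable section

/-- The Laplacian of a function on `ℝ²`, as the trace of the second derivative. -/
def laplacian (φ : EuclideanSpace ℝ (Fin 2) → ℝ) (x : EuclideanSpace ℝ (Fin 2)) : ℝ :=
  ∑ i : Fin 2,
    fderiv ℝ (fun y => fderiv ℝ φ y (EuclideanSpace.single i 1)) x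
      (EuclideanSpace.single i 1)

section

open Set Filter Topology

local notation "𝔼" => EuclideanSpace ℝ (Fin 2)

theorem integral_fderiv_apply_eq_zero {f : 𝔼 → ℝ} (hf : ContDiff ℝ 1 f)
    (hc : HasCompactSupport f) (v : 𝔼) : ∫ x, fderiv ℝ f x v = 0 := by
  have h := integral_mul_fderiv_eq_neg_fderiv_mul_of_integrable (μ := (volume : Measure 𝔼))
    (f := fun _ : 𝔼 => (1 : ℝ)) (g := f) (v := v) (by simp)
    (by
      simp only [one_mul]
      exact ((hf.continuous_fderiv one_ne_zero).clm_apply continuous_const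
        ).integrable_of_hasCompactSupport (hc.fderiv_apply ℝ v))
    (by simpa using hf.continuous.integrable_of_hasCompactSupport hc)
    (fun x _ => by fun_prop) (fun x _ => hf.differentiable one_ne_zero x)
  simpa using h

theorem norm_sq_eq_sum_apply_single (l : 𝔼 →L[ℝ] ℝ) :
    ‖l‖ ^ 2 = l (EuclideanSpace.single 0 1) ^ 2 + l (EuclideanSpace.single 1 1) ^ 2 := by
  obtain ⟨v, rfl⟩ := (InnerProductSpace.toDual ℝ 𝔼).surjective l
  simp [EuclideanSpace.norm_sq_eq, EuclideanSpace.inner_single_right]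

theorem apply_eq_sum_apply_single (l : 𝔼 →L[ℝ] ℝ) (x : 𝔼) :
    l x = x 0 * l (EuclideanSpace.single 0 1) + x 1 * l (EuclideanSpace.single 1 1) := by
  obtain ⟨v, rfl⟩ := (InnerProductSpace.toDual ℝ 𝔼).surjective l
  simp [PiLp.inner_apply]

theorem integrable_indicator_log_norm :
    Integrable (indicator (Metric.ball (0 : 𝔼) 1) fun z => Real.log ‖z‖) := by
  have hm : Measurable (fun z : 𝔼 => Real.log ‖z‖) := by fun_prop
  have h := integrableOn_ball_of_norm_le_rpow (μ := (volume : Measure 𝔼)) (C := 1) (α := 1)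
    (r := 1) (by simp) (by simp)
    (f := indicator (Metric.ball (0 : 𝔼) 1) fun z => Real.log ‖z‖) (by
      refine ae_restrict_of_ae (Eventually.of_forall fun z => ?_)
      by_cases hz : z ∈ Metric.ball (0 : 𝔼) 1
      · rw [indicator_of_mem hz, Real.rpow_neg_one, one_mul]
        rcases eq_or_ne z 0 with rfl | h0
        · simp
        · have hp := norm_pos_iff.2 h0
          have := Real.abs_log_mul_self_lt ‖z‖ hp (by simpa using (mem_ball_zero_iff.1 hz).le)
          rw [abs_mul, abs_of_pos hp] at this
          rw [Real.norm_eq_abs, ← one_div, le_div_iff₀ hp]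
          exact this.le
      · rw [indicator_of_notMem hz, norm_zero]; positivity)
    (hm.aestronglyMeasurable.indicator measurableSet_ball)
  rw [integrable_indicator_iff measurableSet_ball]
  exact h.congr_fun (fun x hx => indicator_of_mem hx _) measurableSet_ball

theorem log_one_add_norm_sub_le (x y : 𝔼) :
    Real.log (1 + ‖x - y‖) ≤ Real.log (1 + ‖x‖) + Real.log (1 + ‖y‖) := by
  rw [← Real.log_mul (by positivity) (by positivity)]
  refine Real.log_le_log (by positivity) ?_
  nlinarith [norm_sub_le x y, norm_nonneg x, norm_nonneg y, mul_nonneg (norm_nonneg x) (norm_nonneg y)]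

theorem abs_log_norm_sub_le (x y : 𝔼) :
    |Real.log ‖x - y‖| ≤ |indicator (Metric.ball (0 : 𝔼) 1) (fun z => Real.log ‖z‖) (x - y)|
      + (Real.log (1 + ‖x‖) + Real.log (1 + ‖y‖)) := by
  have h0 : ∀ z : 𝔼, 0 ≤ Real.log (1 + ‖z‖) := fun z =>
    Real.log_nonneg (by linarith [norm_nonneg z])
  by_cases hz : x - y ∈ Metric.ball (0 : 𝔼) 1
  · rw [indicator_of_mem hz]
    linarith [h0 x, h0 y]
  · rw [indicator_of_notMem hz, abs_zero, zero_add]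
    rw [mem_ball_zero_iff, not_lt] at hz
    rw [abs_of_nonneg (Real.log_nonneg hz)]
    exact (Real.log_le_log (by linarith) (by linarith)).trans (log_one_add_norm_sub_le x y)

theorem integrable_log_weight_mul {u g : 𝔼 → ℝ} (hu : Integrable u) (hg : Integrable g)
    (hlu : Integrable fun x => Real.log (1 + ‖x‖) * u x)
    (hlg : Integrable fun x => Real.log (1 + ‖x‖) * g x) :
    Integrable fun p : 𝔼 × 𝔼 =>
      (Real.log (1 + ‖p.1‖) + Real.log (1 + ‖p.2‖)) * (g p.1 * u p.2) := by
  refine ((hlg.mul_prod hu).add (hg.mul_prod hlu)).congr (Eventually.of_forall fun p => ?_)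
  simp only [Pi.add_apply]
  ring

theorem integrable_log_norm_sub_mul {u g : 𝔼 → ℝ} {M : ℝ} (hu : Integrable u) (hg : Integrable g)
    (hlu : Integrable fun x => Real.log (1 + ‖x‖) * u x)
    (hlg : Integrable fun x => Real.log (1 + ‖x‖) * g x) (hM : ∀ x, |g x| ≤ M) :
    Integrable fun p : 𝔼 × 𝔼 => Real.log ‖p.1 - p.2‖ * (g p.1 * u p.2) := by
  have hk := hu.convolution_integrand (ContinuousLinearMap.mul ℝ ℝ) integrable_indicator_log_norm
    (μ := volume)
  have hw := integrable_log_weight_mul hu hg hlu hlg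
  have hm : Measurable (fun p : 𝔼 × 𝔼 => Real.log ‖p.1 - p.2‖) := by fun_prop
  refine ((hk.norm.const_mul M).add hw.norm).mono'
    (hm.aestronglyMeasurable.mul (hg.mul_prod hu).aestronglyMeasurable)
    (Eventually.of_forall fun p => ?_)
  have h1 := abs_log_norm_sub_le p.1 p.2
  have h0 : ∀ z : 𝔼, 0 ≤ Real.log (1 + ‖z‖) := fun z =>
    Real.log_nonneg (by linarith [norm_nonneg z])
  simp only [Pi.add_apply, norm_mul, Real.norm_eq_abs, ContinuousLinearMap.mul_apply']
  rw [abs_of_nonneg (add_nonneg (h0 p.1) (h0 p.2))]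
  set K := |indicator (Metric.ball (0 : 𝔼) 1) (fun z => Real.log ‖z‖) (p.1 - p.2)|
  have hK : 0 ≤ K := abs_nonneg _
  calc |Real.log ‖p.1 - p.2‖| * (|g p.1| * |u p.2|)
      ≤ (K + (Real.log (1 + ‖p.1‖) + Real.log (1 + ‖p.2‖))) * (|g p.1| * |u p.2|) := by gcongr
    _ = |g p.1| * (|u p.2| * K)
        + (Real.log (1 + ‖p.1‖) + Real.log (1 + ‖p.2‖)) * (|g p.1| * |u p.2|) := by ring
    _ ≤ M * (|u p.2| * K)
        + (Real.log (1 + ‖p.1‖) + Real.log (1 + ‖p.2‖)) * (|g p.1| * |u p.2|) := by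
      gcongr
      exact hM _

theorem ae_prod_fst_ne_snd : ∀ᵐ p : 𝔼 × 𝔼, p.1 ≠ p.2 := by
  have hs : MeasurableSet {p : 𝔼 × 𝔼 | p.1 = p.2} :=
    measurableSet_eq_fun measurable_fst measurable_snd
  have : (volume : Measure (𝔼 × 𝔼)) {p : 𝔼 × 𝔼 | p.1 = p.2} = 0 := by
    rw [Measure.volume_eq_prod, Measure.measure_prod_null hs]
    refine Eventually.of_forall fun x => ?_
    have : Prod.mk x ⁻¹' {p : 𝔼 × 𝔼 | p.1 = p.2} = {x} := by
      ext y; simp [eq_comm]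
    simp [this]
  exact measure_eq_zero_iff_ae_notMem.1 this

/-- A sequence of cutoff functions exhausting the plane, with `‖x‖ ‖∇χₙ(x)‖` uniformly bounded. -/
theorem exists_cutoff_seq : ∃ (C : ℝ) (χ : ℕ → 𝔼 → ℝ), (∀ n, ContDiff ℝ 2 (χ n)) ∧
    (∀ n, HasCompactSupport (χ n)) ∧ (∀ n x, |χ n x| ≤ 1) ∧
    (∀ x, ∀ᶠ n in atTop, χ n x = 1 ∧ fderiv ℝ (χ n) x = 0) ∧
    (∀ n x, ‖fderiv ℝ (χ n) x‖ ≤ C) ∧ (∀ n x, ‖x‖ * ‖fderiv ℝ (χ n) x‖ ≤ C) := by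
  let f : ContDiffBump (0 : 𝔼) := ⟨1, 2, one_pos, one_lt_two⟩
  have hf : ContDiff ℝ 2 (f : 𝔼 → ℝ) := f.contDiff
  have hfc : Continuous (fderiv ℝ f) := hf.continuous_fderiv two_ne_zero
  obtain ⟨C₁, hC₁⟩ := hfc.bounded_above_of_compact_support (f.hasCompactSupport.fderiv ℝ)
  obtain ⟨C₂, hC₂⟩ := (continuous_norm.smul hfc).bounded_above_of_compact_support
    ((f.hasCompactSupport.fderiv ℝ).smul_left)
  have hd : ∀ (n : ℕ) (x : 𝔼), fderiv ℝ (fun y => f (((n : ℝ) + 1)⁻¹ • y)) x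
      = ((n : ℝ) + 1)⁻¹ • fderiv ℝ f (((n : ℝ) + 1)⁻¹ • x) := fun n x => by
    rw [fderiv_comp_smul]
  have hn : ∀ n : ℕ, ‖((n : ℝ) + 1)⁻¹‖ ≤ 1 := fun n => by
    rw [norm_inv, Real.norm_of_nonneg (by positivity)]
    exact inv_le_one_of_one_le₀ (by linarith [(Nat.cast_nonneg n : (0 : ℝ) ≤ n)])
  refine ⟨max C₁ C₂, fun n x => f (((n : ℝ) + 1)⁻¹ • x), fun n => ?_, fun n => ?_, fun n x => ?_,
    fun x => ?_, fun n x => ?_, fun n x => ?_⟩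
  · exact hf.comp (contDiff_const_smul _)
  · exact f.hasCompactSupport.comp_homeomorph
      (Homeomorph.smulOfNeZero (((n : ℝ) + 1)⁻¹) (by positivity))
  · rw [abs_of_nonneg f.nonneg]
    exact f.le_one
  · have ht : Tendsto (fun n : ℕ => ((n : ℝ) + 1)⁻¹ • x) atTop (𝓝 0) := by
      have := (tendsto_one_div_add_atTop_nhds_zero_nat (𝕜 := ℝ)).smul_const x
      simpa using this
    filter_upwards [ht.eventually (f.eventuallyEq_one.eventuallyEq_nhds)] with n h
    refine ⟨h.eq_of_nhds, ?_⟩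
    rw [hd, h.fderiv_eq]
    simp
  · rw [hd, norm_smul]
    calc _ ≤ 1 * C₁ := by gcongr; exacts [hn n, hC₁ _]
      _ ≤ _ := by simp
  · rw [hd, norm_smul, ← mul_assoc, mul_comm ‖x‖, ← norm_smul]
    have := hC₂ (((n : ℝ) + 1)⁻¹ • x)
    rw [Pi.smul_apply', norm_smul, norm_norm] at this
    exact this.trans (le_max_right _ _)

theorem integral_divergence_eq_zero {f g D : 𝔼 → ℝ} (hf : ContDiff ℝ 1 f) (hg : ContDiff ℝ 1 g)
    (hcf : HasCompactSupport f) (hcg : HasCompactSupport g)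
    (hD : ∀ x, fderiv ℝ f x (EuclideanSpace.single 0 1)
      + fderiv ℝ g x (EuclideanSpace.single 1 1) = D x) : ∫ x, D x = 0 := by
  have hi : ∀ {h : 𝔼 → ℝ} (v : 𝔼), ContDiff ℝ 1 h → HasCompactSupport h →
      Integrable fun x => fderiv ℝ h x v := fun v hh hc =>
    ((hh.continuous_fderiv one_ne_zero).clm_apply continuous_const
      ).integrable_of_hasCompactSupport (hc.fderiv_apply ℝ v)
  simp_rw [← hD]
  rw [integral_add (hi _ hf hcf) (hi _ hg hcg), integral_fderiv_apply_eq_zero hf hcf,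
    integral_fderiv_apply_eq_zero hg hcg, add_zero]

theorem hasFDerivAt_coord (i : Fin 2) (x : 𝔼) :
    HasFDerivAt (fun y : 𝔼 => y i) (EuclideanSpace.proj i : 𝔼 →L[ℝ] ℝ) x :=
  (EuclideanSpace.proj i : 𝔼 →L[ℝ] ℝ).hasFDerivAt

theorem contDiff_coord (i : Fin 2) {n : WithTop ℕ∞} : ContDiff ℝ n (fun y : 𝔼 => y i) :=
  (EuclideanSpace.proj i : 𝔼 →L[ℝ] ℝ).contDiff

/-- The inner product of the gradients of two functions on the plane. -/
def gradInner (f g : 𝔼 → ℝ) (x : 𝔼) : ℝ :=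
  fderiv ℝ f x (EuclideanSpace.single 0 1) * fderiv ℝ g x (EuclideanSpace.single 0 1)
    + fderiv ℝ f x (EuclideanSpace.single 1 1) * fderiv ℝ g x (EuclideanSpace.single 1 1)

theorem abs_gradInner_le (f g : 𝔼 → ℝ) (x : 𝔼) :
    |gradInner f g x| ≤ ‖fderiv ℝ f x‖ * ‖fderiv ℝ g x‖ := by
  refine abs_le_of_sq_le_sq ?_ (by positivity)
  rw [mul_pow, norm_sq_eq_sum_apply_single, norm_sq_eq_sum_apply_single, gradInner]
  nlinarith [sq_nonneg (fderiv ℝ f x (EuclideanSpace.single 0 1)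
    * fderiv ℝ g x (EuclideanSpace.single 1 1) - fderiv ℝ f x (EuclideanSpace.single 1 1)
    * fderiv ℝ g x (EuclideanSpace.single 0 1))]

section Identities

variable {φ χ : 𝔼 → ℝ}

theorem contDiff_fderiv_apply_const (hφ : ContDiff ℝ 2 φ) (v : 𝔼) :
    ContDiff ℝ 1 fun y => fderiv ℝ φ y v :=
  (hφ.fderiv_right (m := 1) (by norm_num)).clm_apply contDiff_const

theorem continuous_gradInner (hφ : ContDiff ℝ 1 φ) (hχ : ContDiff ℝ 1 χ) :
    Continuous (gradInner φ χ) := by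
  have h1 := hφ.continuous_fderiv one_ne_zero
  have h2 := hχ.continuous_fderiv one_ne_zero
  unfold gradInner
  fun_prop

theorem continuous_laplacian (hφ : ContDiff ℝ 2 φ) : Continuous (laplacian φ) := by
  unfold laplacian
  exact continuous_finsetSum _ fun i _ =>
    ((contDiff_fderiv_apply_const hφ _).continuous_fderiv one_ne_zero).clm_apply continuous_const

theorem fderiv_fderiv_apply_comm (hφ : ContDiff ℝ 2 φ) (x v w : 𝔼) :
    fderiv ℝ (fun y => fderiv ℝ φ y v) x w = fderiv ℝ (fun y => fderiv ℝ φ y w) x v := by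
  have hd : DifferentiableAt ℝ (fderiv ℝ φ) x :=
    (hφ.fderiv_right (m := 1) (by norm_num)).differentiable one_ne_zero x
  have h : ∀ v, HasFDerivAt (fun y => fderiv ℝ φ y v) ((fderiv ℝ (fderiv ℝ φ) x).flip v) x :=
    fun v => by
      have := hd.hasFDerivAt.clm_apply (hasFDerivAt_const v x)
      simpa using this
  rw [(h v).fderiv, (h w).fderiv]
  exact (hφ.contDiffAt.isSymmSndFDerivAt (by simp)) w v

/-- Green's identity for `χ φ ∇φ`. -/
theorem integral_green_cutoff (hφ : ContDiff ℝ 2 φ) (hχ : ContDiff ℝ 2 χ)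
    (hc : HasCompactSupport χ) :
    ∫ x, (χ x * ‖fderiv ℝ φ x‖ ^ 2 + χ x * (φ x * laplacian φ x) + φ x * gradInner φ χ x) = 0 := by
  have hφ1 : ContDiff ℝ 1 φ := hφ.of_le (by norm_num)
  have hχ1 : ContDiff ℝ 1 χ := hχ.of_le (by norm_num)
  have hp := contDiff_fderiv_apply_const hφ
  refine integral_divergence_eq_zero
    (f := fun x => χ x * (φ x * fderiv ℝ φ x (EuclideanSpace.single 0 1)))
    (g := fun x => χ x * (φ x * fderiv ℝ φ x (EuclideanSpace.single 1 1)))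
    (hχ1.mul (hφ1.mul (hp _))) (hχ1.mul (hφ1.mul (hp _))) hc.mul_right hc.mul_right fun x => ?_
  have h : ∀ v, HasFDerivAt (fun x => χ x * (φ x * fderiv ℝ φ x v)) _ x := fun v =>
    (hχ1.differentiable one_ne_zero x).hasFDerivAt.mul
      ((hφ1.differentiable one_ne_zero x).hasFDerivAt.mul
        ((hp v).differentiable one_ne_zero x).hasFDerivAt)
  rw [(h _).fderiv, (h _).fderiv, norm_sq_eq_sum_apply_single, laplacian, gradInner]
  simp only [Fin.sum_univ_two, add_apply, smul_apply,
    smul_eq_mul]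
  ring

/-- The Pohozaev identity in the plane, localised by a cutoff. -/
theorem integral_pohozaev_cutoff (hφ : ContDiff ℝ 2 φ) (hχ : ContDiff ℝ 2 χ)
    (hc : HasCompactSupport χ) :
    ∫ x, (laplacian φ x * fderiv ℝ φ x (χ x • x) + (gradInner φ χ x * fderiv ℝ φ x x
      - 1 / 2 * (fderiv ℝ χ x x * ‖fderiv ℝ φ x‖ ^ 2))) = 0 := by
  have hχ1 : ContDiff ℝ 1 χ := hχ.of_le (by norm_num)
  have hp := contDiff_fderiv_apply_const hφ
  have hx := fun i => contDiff_coord i (n := 1)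
  set e : Fin 2 → 𝔼 := fun i => EuclideanSpace.single i 1 with he
  refine integral_divergence_eq_zero
    (f := fun x => χ x * (x 0 * (fderiv ℝ φ x (e 0) * fderiv ℝ φ x (e 0))
      + 2 * (x 1 * (fderiv ℝ φ x (e 1) * fderiv ℝ φ x (e 0)))
      - x 0 * (fderiv ℝ φ x (e 1) * fderiv ℝ φ x (e 1))) * (1 / 2))
    (g := fun x => χ x * (x 1 * (fderiv ℝ φ x (e 1) * fderiv ℝ φ x (e 1))
      + 2 * (x 0 * (fderiv ℝ φ x (e 0) * fderiv ℝ φ x (e 1)))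
      - x 1 * (fderiv ℝ φ x (e 0) * fderiv ℝ φ x (e 0))) * (1 / 2))
    ?_ ?_ hc.mul_right.mul_right hc.mul_right.mul_right fun x => ?_
  · have := hx 0; have := hx 1; have := hp (e 0); have := hp (e 1)
    fun_prop
  · have := hx 0; have := hx 1; have := hp (e 0); have := hp (e 1)
    fun_prop
  have h : ∀ i j : Fin 2, HasFDerivAt (fun x => χ x * (x i * (fderiv ℝ φ x (e i) * fderiv ℝ φ x (e i))
      + 2 * (x j * (fderiv ℝ φ x (e j) * fderiv ℝ φ x (e i)))
      - x i * (fderiv ℝ φ x (e j) * fderiv ℝ φ x (e j))) * (1 / 2)) _ x := fun i j => by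
    have d := fun i => ((hp (e i)).differentiable one_ne_zero x).hasFDerivAt
    have c := fun i => hasFDerivAt_coord i x
    exact ((hχ1.differentiable one_ne_zero x).hasFDerivAt.mul
      ((((c i).mul ((d i).mul (d i))).add (((c j).mul ((d j).mul (d i))).const_mul 2)).sub
        ((c i).mul ((d j).mul (d j))))).mul_const _
  rw [(h 0 1).fderiv, (h 1 0).fderiv, norm_sq_eq_sum_apply_single, laplacian, gradInner,
    apply_eq_sum_apply_single (fderiv ℝ φ x) (χ x • x), apply_eq_sum_apply_single (fderiv ℝ φ x) x,
    apply_eq_sum_apply_single (fderiv ℝ χ x) x]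
  have hs := fderiv_fderiv_apply_comm hφ x (e 0) (e 1)
  simp only [he] at hs
  simp [Fin.sum_univ_two, he]
  rw [hs]
  ring

theorem integral_divergence_radial_cutoff {η u : 𝔼 → ℝ} (hη : ContDiff ℝ 1 η)
    (hu : ContDiff ℝ 1 u) (hχ : ContDiff ℝ 1 χ) (hc : HasCompactSupport χ) :
    ∫ x, (fderiv ℝ η x (χ x • x) * u x
      + η x * ((2 * χ x + fderiv ℝ χ x x) * u x + fderiv ℝ u x (χ x • x))) = 0 := by
  have hx := fun i => contDiff_coord i (n := 1)
  refine integral_divergence_eq_zero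
    (f := fun x => χ x * (x 0 * (η x * u x))) (g := fun x => χ x * (x 1 * (η x * u x)))
    (hχ.mul ((hx 0).mul (hη.mul hu))) (hχ.mul ((hx 1).mul (hη.mul hu)))
    hc.mul_right hc.mul_right fun x => ?_
  have h : ∀ i : Fin 2, HasFDerivAt (fun x : 𝔼 => χ x * (x i * (η x * u x))) _ x := fun i =>
    (hχ.differentiable one_ne_zero x).hasFDerivAt.mul
      ((hasFDerivAt_coord i x).mul
        ((hη.differentiable one_ne_zero x).hasFDerivAt.mul
          (hu.differentiable one_ne_zero x).hasFDerivAt))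
  rw [(h 0).fderiv, (h 1).fderiv, apply_eq_sum_apply_single (fderiv ℝ η x) (χ x • x),
    apply_eq_sum_apply_single (fderiv ℝ χ x) x, apply_eq_sum_apply_single (fderiv ℝ u x) (χ x • x)]
  simp
  ring

end Identities

/-- The regularisation `½ log (‖z‖² + ε)` of the logarithmic kernel. -/
def regLog (ε : ℝ) (z : 𝔼) : ℝ := 1 / 2 * Real.log (‖z‖ ^ 2 + ε)

theorem contDiff_regLog {ε : ℝ} (hε : 0 < ε) : ContDiff ℝ 1 (regLog ε) :=
  contDiff_const.mul (((contDiff_norm_sq ℝ).add contDiff_const).log fun z => by positivity)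

theorem fderiv_regLog {ε : ℝ} (hε : 0 < ε) (z v : 𝔼) :
    fderiv ℝ (regLog ε) z v = inner ℝ z v / (‖z‖ ^ 2 + ε) := by
  have h : HasFDerivAt (regLog ε) _ z :=
    (((hasStrictFDerivAt_norm_sq z).hasFDerivAt.add_const ε).log
      (by positivity : ‖z‖ ^ 2 + ε ≠ 0)).const_mul (1 / 2)
  rw [h.fderiv]
  simp
  ring

theorem abs_regLog_le {ε : ℝ} (hε : 0 < ε) (hε1 : ε ≤ 1) {z : 𝔼} (hz : z ≠ 0) :
    |regLog ε z| ≤ |Real.log ‖z‖| + Real.log (1 + ‖z‖) := by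
  have hp : 0 < ‖z‖ := norm_pos_iff.2 hz
  have h0 : 0 ≤ Real.log (1 + ‖z‖) := Real.log_nonneg (by linarith)
  have h1 : Real.log (‖z‖ ^ 2) ≤ Real.log (‖z‖ ^ 2 + ε) :=
    Real.log_le_log (by positivity) (by linarith)
  have h2 : Real.log (‖z‖ ^ 2 + ε) ≤ Real.log ((1 + ‖z‖) ^ 2) :=
    Real.log_le_log (by positivity) (by nlinarith)
  rw [Real.log_pow] at h1 h2
  push_cast at h1 h2
  rw [regLog, abs_le]
  constructor
  · linarith [neg_abs_le (Real.log ‖z‖)]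
  · linarith [abs_nonneg (Real.log ‖z‖)]

theorem tendsto_regLog {z : 𝔼} (hz : z ≠ 0) :
    Tendsto (fun n : ℕ => regLog (1 / ((n : ℝ) + 1)) z) atTop (𝓝 (Real.log ‖z‖)) := by
  have hp : ‖z‖ ^ 2 + 0 ≠ 0 := by simpa using hz
  have h := (((tendsto_one_div_add_atTop_nhds_zero_nat (𝕜 := ℝ)).const_add (‖z‖ ^ 2)).log
    hp).const_mul (1 / 2)
  have he : 1 / 2 * Real.log (‖z‖ ^ 2 + 0) = Real.log ‖z‖ := by
    rw [add_zero, Real.log_pow]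
    push_cast
    ring
  rw [he] at h
  exact h

section RadialCutoff

variable {u χ : 𝔼 → ℝ}

theorem integrable_prod_mul_of_continuous_of_bounded {F : 𝔼 × 𝔼 → ℝ} {C : ℝ}
    (hu : Integrable u) (hF : AEStronglyMeasurable F) (hC : ∀ p, |F p| ≤ C) :
    Integrable fun p : 𝔼 × 𝔼 => F p * (u p.1 * u p.2) :=
  (hu.mul_prod hu).bdd_mul hF (Eventually.of_forall hC)

theorem abs_inner_sub_le_of_lipschitz {X : 𝔼 → 𝔼} {K : ℝ} (hL : ∀ x y, ‖X x - X y‖ ≤ K * ‖x - y‖)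
    (x y : 𝔼) : |inner ℝ (x - y) (X x - X y)| ≤ K * ‖x - y‖ ^ 2 := by
  calc _ ≤ ‖x - y‖ * ‖X x - X y‖ := abs_real_inner_le_norm _ _
    _ ≤ ‖x - y‖ * (K * ‖x - y‖) := by gcongr; exact hL x y
    _ = _ := by ring

theorem abs_inner_div_le_of_lipschitz {X : 𝔼 → 𝔼} {K ε : ℝ} (hε : 0 ≤ ε) (hK : 0 ≤ K)
    (hL : ∀ x y, ‖X x - X y‖ ≤ K * ‖x - y‖) (x y : 𝔼) :
    |inner ℝ (x - y) (X x - X y) / (‖x - y‖ ^ 2 + ε)| ≤ K := by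
  rw [abs_div, abs_of_nonneg (by positivity : 0 ≤ ‖x - y‖ ^ 2 + ε)]
  refine div_le_of_le_mul₀ (by positivity) hK ?_
  exact (abs_inner_sub_le_of_lipschitz hL x y).trans (by gcongr; linarith)

theorem integral_regLog_mul {ε M : ℝ} (hε : 0 < ε) (hu : ContDiff ℝ 1 u) (hui : Integrable u)
    (hχ : ContDiff ℝ 1 χ) (hc : HasCompactSupport χ) (hM : ∀ x, ‖χ x • x‖ ≤ M)
    (hint : Integrable fun p : 𝔼 × 𝔼 => regLog ε (p.1 - p.2) *
      (((2 * χ p.1 + fderiv ℝ χ p.1 p.1) * u p.1 + fderiv ℝ u p.1 (χ p.1 • p.1)) * u p.2)) :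
    ∫ p : 𝔼 × 𝔼, regLog ε (p.1 - p.2) *
      (((2 * χ p.1 + fderiv ℝ χ p.1 p.1) * u p.1 + fderiv ℝ u p.1 (χ p.1 • p.1)) * u p.2)
    = -(1 / 2) * ∫ p : 𝔼 × 𝔼, inner ℝ (p.1 - p.2) (χ p.1 • p.1 - χ p.2 • p.2)
        / (‖p.1 - p.2‖ ^ 2 + ε) * (u p.1 * u p.2) := by
  have hχc := hχ.continuous
  have hM0 : 0 ≤ M := (norm_nonneg _).trans (hM 0)
  have hK : Integrable fun p : 𝔼 × 𝔼 => inner ℝ (p.1 - p.2) (χ p.1 • p.1)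
      / (‖p.1 - p.2‖ ^ 2 + ε) * (u p.1 * u p.2) := by
    refine integrable_prod_mul_of_continuous_of_bounded (C := M * (1 + 1 / ε)) hui
      (Continuous.aestronglyMeasurable ?_) fun p => ?_
    · refine Continuous.div (by fun_prop) (by fun_prop) fun p => by positivity
    · rw [abs_div, abs_of_pos (by positivity : 0 < ‖p.1 - p.2‖ ^ 2 + ε)]
      refine div_le_of_le_mul₀ (by positivity) (by positivity) ?_
      calc _ ≤ ‖p.1 - p.2‖ * ‖χ p.1 • p.1‖ := abs_real_inner_le_norm _ _
        _ ≤ ‖p.1 - p.2‖ * M := by gcongr; exact hM _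
        _ ≤ ((1 + 1 / ε) * (‖p.1 - p.2‖ ^ 2 + ε)) * M := by
          gcongr
          have : (1 + 1 / ε) * (‖p.1 - p.2‖ ^ 2 + ε)
              = ‖p.1 - p.2‖ ^ 2 + 1 + ε + ‖p.1 - p.2‖ ^ 2 / ε := by
            field_simp
            ring
          have h2 : 0 ≤ ‖p.1 - p.2‖ ^ 2 / ε := by positivity
          nlinarith [sq_nonneg (‖p.1 - p.2‖ - 1)]
        _ = _ := by ring
  have hzero : ∫ p : 𝔼 × 𝔼, (inner ℝ (p.1 - p.2) (χ p.1 • p.1)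
      / (‖p.1 - p.2‖ ^ 2 + ε) * (u p.1 * u p.2) + regLog ε (p.1 - p.2) *
      (((2 * χ p.1 + fderiv ℝ χ p.1 p.1) * u p.1 + fderiv ℝ u p.1 (χ p.1 • p.1)) * u p.2)) = 0 := by
    refine (integral_prod_symm _ (hK.add hint)).trans ?_
    refine integral_eq_zero_of_ae (Eventually.of_forall fun y => ?_)
    have h := integral_divergence_radial_cutoff (η := fun x => regLog ε (x - y))
      ((contDiff_regLog hε).comp (contDiff_id.sub contDiff_const)) hu hχ hc
    rw [Pi.zero_apply, ← zero_mul (u y), ← h, ← integral_mul_const]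
    refine integral_congr_ae (Eventually.of_forall fun x => ?_)
    simp only [Pi.add_apply, fderiv_comp_sub, fderiv_regLog hε]
    ring
  rw [integral_add hK hint] at hzero
  have hs : ∫ p : 𝔼 × 𝔼, inner ℝ (p.1 - p.2) (χ p.1 • p.1 - χ p.2 • p.2)
        / (‖p.1 - p.2‖ ^ 2 + ε) * (u p.1 * u p.2)
      = 2 * ∫ p : 𝔼 × 𝔼, inner ℝ (p.1 - p.2) (χ p.1 • p.1)
        / (‖p.1 - p.2‖ ^ 2 + ε) * (u p.1 * u p.2) := by
    have hsw := integral_prod_swap (μ := (volume : Measure 𝔼)) (ν := (volume : Measure 𝔼))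
      fun p : 𝔼 × 𝔼 => inner ℝ (p.1 - p.2) (χ p.1 • p.1) / (‖p.1 - p.2‖ ^ 2 + ε) * (u p.1 * u p.2)
    rw [← Measure.volume_eq_prod] at hsw
    rw [two_mul]
    nth_rewrite 2 [← hsw]
    refine Eq.trans ?_ (integral_add hK hK.swap)
    refine integral_congr_ae (Eventually.of_forall fun p => ?_)
    simp only [Prod.fst_swap, Prod.snd_swap]
    rw [norm_sub_rev p.2 p.1, inner_sub_right, ← neg_sub p.1 p.2, inner_neg_left]
    ring
  rw [hs]
  linarith

theorem integral_log_mul {M K : ℝ} (hu : ContDiff ℝ 1 u) (hui : Integrable u)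
    (hlu : Integrable fun x => Real.log (1 + ‖x‖) * u x)
    (hχ : ContDiff ℝ 1 χ) (hc : HasCompactSupport χ) (hM : ∀ x, ‖χ x • x‖ ≤ M) (hK : 0 ≤ K)
    (hL : ∀ x y, ‖χ x • x - χ y • y‖ ≤ K * ‖x - y‖)
    {g : 𝔼 → ℝ} (hg : ∀ x, g x = (2 * χ x + fderiv ℝ χ x x) * u x + fderiv ℝ u x (χ x • x))
    (hgi : Integrable g) (hlg : Integrable fun x => Real.log (1 + ‖x‖) * g x)
    (hlogg : Integrable fun p : 𝔼 × 𝔼 => Real.log ‖p.1 - p.2‖ * (g p.1 * u p.2)) :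
    ∫ p : 𝔼 × 𝔼, Real.log ‖p.1 - p.2‖ * (g p.1 * u p.2)
    = -(1 / 2) * ∫ p : 𝔼 × 𝔼, inner ℝ (p.1 - p.2) (χ p.1 • p.1 - χ p.2 • p.2)
        / ‖p.1 - p.2‖ ^ 2 * (u p.1 * u p.2) := by
  have hχc := hχ.continuous
  set ε : ℕ → ℝ := fun n => 1 / ((n : ℝ) + 1) with hεdef
  have hε : ∀ n, 0 < ε n := fun n => by positivity
  have hε1 : ∀ n, ε n ≤ 1 := fun n => by
    rw [hεdef]
    exact div_le_one_of_le₀ (by linarith [(Nat.cast_nonneg n : (0 : ℝ) ≤ n)]) (by positivity)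
  have hw := integrable_log_weight_mul hui hgi hlu hlg
  have hbi := hlogg.norm.add hw.norm
  have hm : ∀ n, AEStronglyMeasurable
      (fun p : 𝔼 × 𝔼 => regLog (ε n) (p.1 - p.2) * (g p.1 * u p.2)) := fun n =>
    (((contDiff_regLog (hε n)).continuous.comp
      (continuous_fst.sub continuous_snd)).aestronglyMeasurable).mul
      (hgi.mul_prod hui).aestronglyMeasurable
  have hbound : ∀ n, ∀ᵐ p : 𝔼 × 𝔼, ‖regLog (ε n) (p.1 - p.2) * (g p.1 * u p.2)‖
      ≤ ‖Real.log ‖p.1 - p.2‖ * (g p.1 * u p.2)‖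
        + ‖(Real.log (1 + ‖p.1‖) + Real.log (1 + ‖p.2‖)) * (g p.1 * u p.2)‖ := fun n => by
    filter_upwards [ae_prod_fst_ne_snd] with p hp
    rw [norm_mul, norm_mul (Real.log _), norm_mul (Real.log _ + _), ← add_mul]
    gcongr
    exact (abs_regLog_le (hε n) (hε1 n) (sub_ne_zero.2 hp)).trans
      (add_le_add le_rfl ((log_one_add_norm_sub_le _ _).trans (le_abs_self _)))
  have hint : ∀ n, Integrable fun p : 𝔼 × 𝔼 => regLog (ε n) (p.1 - p.2) * (g p.1 * u p.2) :=
    fun n => hbi.mono' (hm n) (hbound n)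
  have heq : ∀ n, ∫ p : 𝔼 × 𝔼, regLog (ε n) (p.1 - p.2) * (g p.1 * u p.2)
      = -(1 / 2) * ∫ p : 𝔼 × 𝔼, inner ℝ (p.1 - p.2) (χ p.1 • p.1 - χ p.2 • p.2)
        / (‖p.1 - p.2‖ ^ 2 + ε n) * (u p.1 * u p.2) := fun n => by
    have := hint n
    simp only [hg] at this ⊢
    exact integral_regLog_mul (hε n) hu hui hχ hc hM this
  have h1 : Tendsto (fun n => ∫ p : 𝔼 × 𝔼, regLog (ε n) (p.1 - p.2) * (g p.1 * u p.2)) atTop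
      (𝓝 (∫ p : 𝔼 × 𝔼, Real.log ‖p.1 - p.2‖ * (g p.1 * u p.2))) := by
    refine tendsto_integral_of_dominated_convergence _ hm hbi hbound ?_
    filter_upwards [ae_prod_fst_ne_snd] with p hp
    exact (tendsto_regLog (sub_ne_zero.2 hp)).mul_const _
  have h2 : Tendsto (fun n => ∫ p : 𝔼 × 𝔼, inner ℝ (p.1 - p.2) (χ p.1 • p.1 - χ p.2 • p.2)
        / (‖p.1 - p.2‖ ^ 2 + ε n) * (u p.1 * u p.2)) atTop
      (𝓝 (∫ p : 𝔼 × 𝔼, inner ℝ (p.1 - p.2) (χ p.1 • p.1 - χ p.2 • p.2)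
        / ‖p.1 - p.2‖ ^ 2 * (u p.1 * u p.2))) := by
    refine tendsto_integral_of_dominated_convergence (fun p => K * ‖u p.1 * u p.2‖) (fun n => ?_)
      ((hui.mul_prod hui).norm.const_mul K) (fun n => Eventually.of_forall fun p => ?_) ?_
    · refine (Continuous.aestronglyMeasurable ?_).mul (hui.mul_prod hui).aestronglyMeasurable
      exact Continuous.div (by fun_prop) (by fun_prop) fun p => by have := hε n; positivity
    · rw [norm_mul]
      gcongr
      exact abs_inner_div_le_of_lipschitz (X := fun x => χ x • x) (hε n).le hK hL _ _
    · filter_upwards [ae_prod_fst_ne_snd] with p hp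
      have hz : ‖p.1 - p.2‖ ^ 2 ≠ 0 := by simpa using sub_ne_zero.2 hp
      refine Tendsto.mul_const _ (tendsto_const_nhds.div ?_ hz)
      have h := (tendsto_one_div_add_atTop_nhds_zero_nat (𝕜 := ℝ)).const_add (‖p.1 - p.2‖ ^ 2)
      rw [add_zero] at h
      exact h
  refine tendsto_nhds_unique h1 ?_
  simp_rw [heq]
  exact h2.const_mul _

end RadialCutoff

theorem integral_log_convolution_mul {u g : 𝔼 → ℝ}
    (h : Integrable fun p : 𝔼 × 𝔼 => Real.log ‖p.1 - p.2‖ * (g p.1 * u p.2)) :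
    ∫ p : 𝔼 × 𝔼, Real.log ‖p.1 - p.2‖ * (g p.1 * u p.2)
      = ∫ x, (∫ y, Real.log ‖x - y‖ * u y) * g x := by
  rw [Measure.volume_eq_prod, integral_prod _ h]
  refine integral_congr_ae (Eventually.of_forall fun x => ?_)
  simp only [← integral_mul_const]
  refine integral_congr_ae (Eventually.of_forall fun y => ?_)
  simp only
  ring

theorem integrable_log_norm_sub_mul_of_hasCompactSupport {u g : 𝔼 → ℝ} (hu : Integrable u)
    (hlu : Integrable fun x => Real.log (1 + ‖x‖) * u x) (hg : Continuous g)
    (hc : HasCompactSupport g) :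
    Integrable g ∧ (Integrable fun x => Real.log (1 + ‖x‖) * g x) ∧
      Integrable fun p : 𝔼 × 𝔼 => Real.log ‖p.1 - p.2‖ * (g p.1 * u p.2) := by
  have h1 := hg.integrable_of_hasCompactSupport (μ := volume) hc
  have hl : Continuous fun x : 𝔼 => Real.log (1 + ‖x‖) :=
    (continuous_const.add continuous_norm).log fun x =>
      (by positivity : (0 : ℝ) < 1 + ‖x‖).ne'
  have h2 : Integrable fun x => Real.log (1 + ‖x‖) * g x :=
    (hl.mul hg).integrable_of_hasCompactSupport hc.mul_left
  obtain ⟨M, hM⟩ := hg.bounded_above_of_compact_support hc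
  exact ⟨h1, h2, integrable_log_norm_sub_mul hu h1 hlu h2 hM⟩

theorem norm_cutoff_smul_sub_le {χ : 𝔼 → ℝ} {C : ℝ} (hχ : ContDiff ℝ 1 χ) (h1 : ∀ x, |χ x| ≤ 1)
    (hC : ∀ x, ‖x‖ * ‖fderiv ℝ χ x‖ ≤ C) (x y : 𝔼) :
    ‖χ x • x - χ y • y‖ ≤ (1 + C) * ‖x - y‖ := by
  have hd : ∀ x, HasFDerivAt (fun x => χ x • x)
      (χ x • ContinuousLinearMap.id ℝ 𝔼 + (fderiv ℝ χ x).smulRight x) x := fun x =>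
    (hχ.differentiable one_ne_zero x).hasFDerivAt.smul (hasFDerivAt_id x)
  refine convex_univ.norm_image_sub_le_of_norm_hasFDerivWithin_le
    (fun z _ => (hd z).hasFDerivWithinAt) (fun z _ => ?_) (mem_univ y) (mem_univ x)
  refine (norm_add_le _ _).trans (add_le_add ?_ ?_)
  · rw [norm_smul, Real.norm_eq_abs]
    exact mul_le_one₀ (h1 z) (norm_nonneg _) ContinuousLinearMap.norm_id_le
  · rw [ContinuousLinearMap.norm_smulRight_apply, mul_comm]
    exact hC z

theorem fderiv_sq_apply {φ : 𝔼 → ℝ} (hφ : Differentiable ℝ φ) (x v : 𝔼) :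
    fderiv ℝ (fun y => φ y ^ 2) x v = 2 * (φ x * fderiv ℝ φ x v) := by
  rw [((hφ x).hasFDerivAt.pow 2).fderiv]
  simp
  ring

section Main

variable {φ : 𝔼 → ℝ}

theorem potential_eq_neg_kinetic (hreg : ContDiff ℝ 2 φ)
    (hpde : ∀ x, laplacian φ x = (1 / (2 * Real.pi)) * (∫ y, Real.log ‖x - y‖ * φ y ^ 2) * φ x)
    (hN : Integrable fun x => φ x ^ 2) (hT : Integrable fun x => ‖fderiv ℝ φ x‖ ^ 2)
    (hV : Integrable fun p : 𝔼 × 𝔼 => Real.log ‖p.1 - p.2‖ * φ p.1 ^ 2 * φ p.2 ^ 2) :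
    (1 / (2 * Real.pi)) * (∫ p : 𝔼 × 𝔼, Real.log ‖p.1 - p.2‖ * φ p.1 ^ 2 * φ p.2 ^ 2)
      = -∫ x, ‖fderiv ℝ φ x‖ ^ 2 := by
  obtain ⟨C, χ, hχ, hc, h1, hlim, hC, -⟩ := exists_cutoff_seq
  have hC0 : 0 ≤ C := (norm_nonneg _).trans (hC 0 0)
  have hφ1 : ContDiff ℝ 1 φ := hreg.of_le (by norm_num)
  have hχ1 : ∀ n, ContDiff ℝ 1 (χ n) := fun n => (hχ n).of_le (by norm_num)
  have hφc := hreg.continuous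
  have hdc := hφ1.continuous_fderiv one_ne_zero
  have hχc := fun n => (hχ n).continuous
  have hgc := fun n => continuous_gradInner hφ1 (hχ1 n)
  have hLc := continuous_laplacian hreg
  have hbG : ∀ n x, ‖φ x * gradInner φ (χ n) x‖ ≤ C * (φ x ^ 2 + ‖fderiv ℝ φ x‖ ^ 2) := fun n x => by
    rw [norm_mul, Real.norm_eq_abs, Real.norm_eq_abs]
    calc _ ≤ |φ x| * (‖fderiv ℝ φ x‖ * C) := by
          gcongr
          exact (abs_gradInner_le _ _ _).trans (by gcongr; exact hC n x)
      _ = C * (|φ x| * ‖fderiv ℝ φ x‖) := by ring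
      _ ≤ _ := by
          gcongr
          nlinarith [sq_nonneg (|φ x| - ‖fderiv ℝ φ x‖), sq_abs (φ x), abs_nonneg (φ x),
            norm_nonneg (fderiv ℝ φ x)]
  have hbi := (hN.add hT).const_mul C
  have hG : ∀ n, Integrable fun x => φ x * gradInner φ (χ n) x := fun n =>
    hbi.mono' (hφc.mul (hgc n)).aestronglyMeasurable (Eventually.of_forall (hbG n))
  have hA : ∀ n, Integrable fun x => χ n x * ‖fderiv ℝ φ x‖ ^ 2 := fun n =>
    hT.bdd_mul (hχc n).aestronglyMeasurable (Eventually.of_forall (h1 n))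
  have hB : ∀ n, Integrable fun x => χ n x * (φ x * laplacian φ x) := fun n =>
    ((hχc n).mul (hφc.mul hLc)).integrable_of_hasCompactSupport (hc n).mul_right
  have hVn : ∀ n, Integrable fun p : 𝔼 × 𝔼 =>
      Real.log ‖p.1 - p.2‖ * ((χ n p.1 * φ p.1 ^ 2) * φ p.2 ^ 2) := fun n =>
    (hV.bdd_mul ((hχc n).comp continuous_fst).aestronglyMeasurable
      (Eventually.of_forall fun p => h1 n p.1)).congr (Eventually.of_forall fun p => by
        simp only [Function.comp_apply]; ring)
  have hW : ∀ n, ∫ x, χ n x * (φ x * laplacian φ x) = (1 / (2 * Real.pi)) *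
      ∫ p : 𝔼 × 𝔼, Real.log ‖p.1 - p.2‖ * ((χ n p.1 * φ p.1 ^ 2) * φ p.2 ^ 2) := fun n => by
    rw [integral_log_convolution_mul (u := fun x => φ x ^ 2) (g := fun x => χ n x * φ x ^ 2) (hVn n),
      ← integral_const_mul]
    refine integral_congr_ae (Eventually.of_forall fun x => ?_)
    simp only [hpde]
    ring
  have hid : ∀ n, (∫ x, χ n x * ‖fderiv ℝ φ x‖ ^ 2) + (1 / (2 * Real.pi)) *
      (∫ p : 𝔼 × 𝔼, Real.log ‖p.1 - p.2‖ * ((χ n p.1 * φ p.1 ^ 2) * φ p.2 ^ 2))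
      + (∫ x, φ x * gradInner φ (χ n) x) = 0 := fun n => by
    rw [← hW, ← integral_add (hA n) (hB n)]
    exact (integral_add ((hA n).add (hB n)) (hG n)).symm.trans
      (integral_green_cutoff hreg (hχ n) (hc n))
  have t1 : Tendsto (fun n => ∫ x, χ n x * ‖fderiv ℝ φ x‖ ^ 2) atTop
      (𝓝 (∫ x, ‖fderiv ℝ φ x‖ ^ 2)) := by
    refine tendsto_integral_of_dominated_convergence _ (fun n => (hA n).aestronglyMeasurable) hT
      (fun n => Eventually.of_forall fun x => ?_) (Eventually.of_forall fun x => ?_)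
    · rw [norm_mul, Real.norm_of_nonneg (sq_nonneg ‖fderiv ℝ φ x‖)]
      exact mul_le_of_le_one_left (by positivity) (h1 n x)
    · refine tendsto_const_nhds.congr' ?_
      filter_upwards [hlim x] with n hn
      rw [hn.1, one_mul]
  have t2 : Tendsto (fun n => ∫ p : 𝔼 × 𝔼,
      Real.log ‖p.1 - p.2‖ * ((χ n p.1 * φ p.1 ^ 2) * φ p.2 ^ 2)) atTop
      (𝓝 (∫ p : 𝔼 × 𝔼, Real.log ‖p.1 - p.2‖ * φ p.1 ^ 2 * φ p.2 ^ 2)) := by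
    refine tendsto_integral_of_dominated_convergence _ (fun n => (hVn n).aestronglyMeasurable)
      hV.norm (fun n => Eventually.of_forall fun p => ?_) (Eventually.of_forall fun p => ?_)
    · calc _ = |χ n p.1| * ‖Real.log ‖p.1 - p.2‖ * φ p.1 ^ 2 * φ p.2 ^ 2‖ := by
            rw [← Real.norm_eq_abs, ← norm_mul]; congr 1; ring
        _ ≤ _ := mul_le_of_le_one_left (norm_nonneg _) (h1 n p.1)
    · refine tendsto_const_nhds.congr' ?_
      filter_upwards [hlim p.1] with n hn
      rw [hn.1]
      ring
  have t3 : Tendsto (fun n => ∫ x, φ x * gradInner φ (χ n) x) atTop (𝓝 (∫ _ : 𝔼, (0 : ℝ))) := by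
    refine tendsto_integral_of_dominated_convergence _ (fun n => (hG n).aestronglyMeasurable) hbi
      (fun n => Eventually.of_forall (hbG n)) (Eventually.of_forall fun x => ?_)
    refine tendsto_const_nhds.congr' ?_
    filter_upwards [hlim x] with n hn
    simp [gradInner, hn.2]
  have h := tendsto_nhds_unique ((t1.add (t2.const_mul (1 / (2 * Real.pi)))).add t3)
    (tendsto_const_nhds.congr fun n => (hid n).symm)
  rw [integral_zero] at h
  linarith

theorem integral_log_eq (hreg : ContDiff ℝ 2 φ)
    (hpde : ∀ x, laplacian φ x = (1 / (2 * Real.pi)) * (∫ y, Real.log ‖x - y‖ * φ y ^ 2) * φ x)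
    (hN : Integrable fun x => φ x ^ 2) (hT : Integrable fun x => ‖fderiv ℝ φ x‖ ^ 2)
    (hX : Integrable fun x => Real.log (1 + ‖x‖) * φ x ^ 2)
    (hV : Integrable fun p : 𝔼 × 𝔼 => Real.log ‖p.1 - p.2‖ * φ p.1 ^ 2 * φ p.2 ^ 2) :
    ∫ p : 𝔼 × 𝔼, Real.log ‖p.1 - p.2‖ * φ p.1 ^ 2 * φ p.2 ^ 2
      = -(1 / 4) * (∫ x, φ x ^ 2) ^ 2 := by
  obtain ⟨C, χ, hχ, hc, h1, hlim, -, hC⟩ := exists_cutoff_seq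
  have hC0 : 0 ≤ C := le_trans (by positivity) (hC 0 0)
  have hφ1 : ContDiff ℝ 1 φ := hreg.of_le (by norm_num)
  have hχ1 : ∀ n, ContDiff ℝ 1 (χ n) := fun n => (hχ n).of_le (by norm_num)
  have hφc := hreg.continuous
  have hdc := hφ1.continuous_fderiv one_ne_zero
  have hχc := fun n => (hχ n).continuous
  have hχdc := fun n => (hχ1 n).continuous_fderiv one_ne_zero
  have hgc := fun n => continuous_gradInner hφ1 (hχ1 n)
  have hLc := continuous_laplacian hreg
  set u : 𝔼 → ℝ := fun x => φ x ^ 2 with hu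
  have hu1 : ContDiff ℝ 1 u := hφ1.pow 2
  have huc := hu1.continuous
  have hudc := hu1.continuous_fderiv one_ne_zero
  have hV' : Integrable fun p : 𝔼 × 𝔼 => Real.log ‖p.1 - p.2‖ * (u p.1 * u p.2) := by
    simpa only [mul_assoc] using hV
  have hDχ : ∀ n x, |fderiv ℝ (χ n) x x| ≤ C := fun n x =>
    ((fderiv ℝ (χ n) x).le_opNorm x).trans (by rw [mul_comm]; exact hC n x)
  -- the remainder in the localised Pohozaev identity
  set R : ℕ → 𝔼 → ℝ := fun n x => gradInner φ (χ n) x * fderiv ℝ φ x x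
    - 1 / 2 * (fderiv ℝ (χ n) x x * ‖fderiv ℝ φ x‖ ^ 2) with hR
  have hRb : ∀ n x, ‖R n x‖ ≤ 2 * C * ‖fderiv ℝ φ x‖ ^ 2 := fun n x => by
    have e1 : ‖gradInner φ (χ n) x * fderiv ℝ φ x x‖ ≤ C * ‖fderiv ℝ φ x‖ ^ 2 := by
      rw [norm_mul]
      calc _ ≤ (‖fderiv ℝ φ x‖ * ‖fderiv ℝ (χ n) x‖) * (‖fderiv ℝ φ x‖ * ‖x‖) := by
            gcongr
            exacts [abs_gradInner_le _ _ _, (fderiv ℝ φ x).le_opNorm x]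
        _ = (‖x‖ * ‖fderiv ℝ (χ n) x‖) * ‖fderiv ℝ φ x‖ ^ 2 := by ring
        _ ≤ _ := by gcongr; exact hC n x
    have e2 : ‖1 / 2 * (fderiv ℝ (χ n) x x * ‖fderiv ℝ φ x‖ ^ 2)‖ ≤ C * ‖fderiv ℝ φ x‖ ^ 2 := by
      rw [norm_mul, norm_mul, Real.norm_of_nonneg (sq_nonneg ‖fderiv ℝ φ x‖), Real.norm_eq_abs,
        Real.norm_eq_abs, abs_of_pos (by norm_num : (0 : ℝ) < 1 / 2)]
      have := mul_le_mul_of_nonneg_right (hDχ n x) (sq_nonneg ‖fderiv ℝ φ x‖)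
      nlinarith [mul_nonneg hC0 (sq_nonneg ‖fderiv ℝ φ x‖)]
    linarith [norm_sub_le (gradInner φ (χ n) x * fderiv ℝ φ x x)
      (1 / 2 * (fderiv ℝ (χ n) x x * ‖fderiv ℝ φ x‖ ^ 2))]
  have hRi : ∀ n, Integrable (R n) := fun n =>
    (hT.const_mul (2 * C)).mono' (Continuous.aestronglyMeasurable (by
      have := hgc n; have := hχdc n; fun_prop)) (Eventually.of_forall (hRb n))
  have tR : Tendsto (fun n => ∫ x, R n x) atTop (𝓝 (∫ _ : 𝔼, (0 : ℝ))) := by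
    refine tendsto_integral_of_dominated_convergence _ (fun n => (hRi n).aestronglyMeasurable)
      (hT.const_mul (2 * C)) (fun n => Eventually.of_forall (hRb n))
      (Eventually.of_forall fun x => tendsto_const_nhds.congr' ?_)
    filter_upwards [hlim x] with n hn
    simp [R, gradInner, hn.2]
  have hXs : ∀ n, HasCompactSupport fun x => χ n x • x := fun n => (hc n).smul_right
  have hXc : ∀ n, Continuous fun x => χ n x • x := fun n => (hχc n).smul continuous_id
  have hfs : ∀ (f : 𝔼 → ℝ) n, HasCompactSupport fun x => fderiv ℝ f x (χ n x • x) := fun f n => by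
    refine (hc n).mono fun x hx => ?_
    contrapose! hx
    simp [Function.notMem_support.1 hx]
  have hJ := fun n => (integrable_log_norm_sub_mul_of_hasCompactSupport hN hX
    (hudc.clm_apply (hXc n)) (hfs u n)).2.2
  have hP : ∀ n, (1 / (4 * Real.pi)) * (∫ p : 𝔼 × 𝔼,
      Real.log ‖p.1 - p.2‖ * (fderiv ℝ u p.1 (χ n p.1 • p.1) * u p.2)) + ∫ x, R n x = 0 :=
    fun n => by
    have hi : Integrable fun x => laplacian φ x * fderiv ℝ φ x (χ n x • x) :=
      (hLc.mul (hdc.clm_apply (hXc n))).integrable_of_hasCompactSupport (hfs φ n).mul_left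
    rw [← integral_pohozaev_cutoff hreg (hχ n) (hc n), integral_add hi (hRi n),
      integral_log_convolution_mul (g := fun x => fderiv ℝ u x (χ n x • x)) (hJ n),
      ← integral_const_mul]
    congr 1
    refine integral_congr_ae (Eventually.of_forall fun x => ?_)
    simp only [hpde, hu, fderiv_sq_apply (hφ1.differentiable one_ne_zero)]
    field_simp
    ring
  set Q : ℕ → 𝔼 × 𝔼 → ℝ := fun n p => Real.log ‖p.1 - p.2‖ *
    (((2 * χ n p.1 + fderiv ℝ (χ n) p.1 p.1) * u p.1) * u p.2) with hQ
  have hQb : ∀ n p, ‖Q n p‖ ≤ (2 + C) * ‖Real.log ‖p.1 - p.2‖ * (u p.1 * u p.2)‖ := fun n p => by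
    calc _ = |2 * χ n p.1 + fderiv ℝ (χ n) p.1 p.1| * ‖Real.log ‖p.1 - p.2‖ * (u p.1 * u p.2)‖ := by
          rw [← Real.norm_eq_abs, ← norm_mul]; congr 1; simp only [hQ]; ring
      _ ≤ _ := by
          gcongr
          refine (abs_add_le _ _).trans (add_le_add ?_ (hDχ n _))
          rw [abs_mul, abs_two]
          linarith [h1 n p.1]
  have hlm : Measurable fun p : 𝔼 × 𝔼 => Real.log ‖p.1 - p.2‖ := by fun_prop
  have hQi : ∀ n, Integrable (Q n) := fun n =>
    (hV'.norm.const_mul (2 + C)).mono' (hlm.aestronglyMeasurable.mul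
      (Continuous.aestronglyMeasurable (by have := hχdc n; fun_prop)))
      (Eventually.of_forall (hQb n))
  have tQ : Tendsto (fun n => ∫ p, Q n p) atTop
      (𝓝 (∫ p : 𝔼 × 𝔼, 2 * (Real.log ‖p.1 - p.2‖ * (u p.1 * u p.2)))) := by
    refine tendsto_integral_of_dominated_convergence _ (fun n => (hQi n).aestronglyMeasurable)
      (hV'.norm.const_mul (2 + C)) (fun n => Eventually.of_forall (hQb n))
      (Eventually.of_forall fun p => tendsto_const_nhds.congr' ?_)
    filter_upwards [hlim p.1] with n hn
    simp only [hQ, hn.1, hn.2, zero_apply]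
    ring
  have hL := fun n => norm_cutoff_smul_sub_le (hχ1 n) (h1 n) (hC n)
  have hS : ∀ n, (∫ p : 𝔼 × 𝔼,
      Real.log ‖p.1 - p.2‖ * (fderiv ℝ u p.1 (χ n p.1 • p.1) * u p.2)) + ∫ p, Q n p
      = -(1 / 2) * ∫ p : 𝔼 × 𝔼, inner ℝ (p.1 - p.2) (χ n p.1 • p.1 - χ n p.2 • p.2)
        / ‖p.1 - p.2‖ ^ 2 * (u p.1 * u p.2) := fun n => by
    obtain ⟨M, hM⟩ := (hXc n).bounded_above_of_compact_support (hXs n)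
    have hχs : HasCompactSupport fun x => fderiv ℝ (χ n) x x := by
      refine ((hc n).fderiv ℝ).mono fun x hx => ?_
      contrapose! hx
      simp [Function.notMem_support.1 hx]
    have hgcs : HasCompactSupport fun x =>
        (2 * χ n x + fderiv ℝ (χ n) x x) * u x + fderiv ℝ u x (χ n x • x) :=
      ((((hc n).mul_left).add hχs).mul_right).add (hfs u n)
    obtain ⟨g1, g2, g3⟩ := integrable_log_norm_sub_mul_of_hasCompactSupport hN hX
      (by have := hχdc n; have := hχc n; fun_prop) hgcs
    rw [← integral_log_mul hu1 hN hX (hχ1 n) (hc n) hM (by positivity) (hL n) (fun _ => rfl)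
      g1 g2 g3, ← integral_add (hJ n) (hQi n)]
    refine integral_congr_ae (Eventually.of_forall fun p => ?_)
    simp only [hQ]
    ring
  have tS : Tendsto (fun n => ∫ p : 𝔼 × 𝔼, inner ℝ (p.1 - p.2) (χ n p.1 • p.1 - χ n p.2 • p.2)
        / ‖p.1 - p.2‖ ^ 2 * (u p.1 * u p.2)) atTop (𝓝 (∫ p : 𝔼 × 𝔼, u p.1 * u p.2)) := by
    refine tendsto_integral_of_dominated_convergence (fun p => (1 + C) * ‖u p.1 * u p.2‖)
      (fun n => ?_) ((hN.mul_prod hN).norm.const_mul (1 + C))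
      (fun n => Eventually.of_forall fun p => ?_) ?_
    · have hn : Continuous fun p : 𝔼 × 𝔼 => inner ℝ (p.1 - p.2) (χ n p.1 • p.1 - χ n p.2 • p.2) := by
        have := hχc n
        fun_prop
      have hd : Continuous fun p : 𝔼 × 𝔼 => ‖p.1 - p.2‖ ^ 2 := by fun_prop
      exact (hn.measurable.div hd.measurable).aestronglyMeasurable.mul
        (hN.mul_prod hN).aestronglyMeasurable
    · rw [norm_mul]
      gcongr
      have := abs_inner_div_le_of_lipschitz (X := fun x => χ n x • x) le_rfl
        (by positivity : 0 ≤ 1 + C) (hL n) p.1 p.2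
      rwa [add_zero] at this
    · filter_upwards [ae_prod_fst_ne_snd] with p hp
      refine tendsto_const_nhds.congr' ?_
      filter_upwards [hlim p.1, hlim p.2] with n hn hn'
      have hz : ‖p.1 - p.2‖ ^ 2 ≠ 0 := by simpa using sub_ne_zero.2 hp
      rw [hn.1, hn'.1, one_smul, one_smul, real_inner_self_eq_norm_sq, div_self hz, one_mul]
  have hJeq : ∀ n, (1 / (4 * Real.pi)) * (-(1 / 2) * (∫ p : 𝔼 × 𝔼,
      inner ℝ (p.1 - p.2) (χ n p.1 • p.1 - χ n p.2 • p.2) / ‖p.1 - p.2‖ ^ 2 * (u p.1 * u p.2))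
      - ∫ p, Q n p) + ∫ x, R n x = 0 := fun n => by
    rw [← hS, add_sub_cancel_right]
    exact hP n
  have h := tendsto_nhds_unique ((((tS.const_mul (-(1 / 2))).sub tQ).const_mul
    (1 / (4 * Real.pi))).add tR) (tendsto_const_nhds.congr fun n => (hJeq n).symm)
  rw [integral_zero, add_zero, mul_eq_zero, Measure.volume_eq_prod, integral_prod_mul,
    ← Measure.volume_eq_prod, integral_const_mul] at h
  have h' := h.resolve_left (by positivity)
  simp only [mul_assoc]
  simp only [hu] at h' ⊢
  linarith

end Main

end

theorem universal_solution_identities (Λ₀ : ℝ)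
    (φ : EuclideanSpace ℝ (Fin 2) → ℝ)
    (hreg : ContDiff ℝ 2 φ)
    (hpde : ∀ x, -laplacian φ x
        + (1 / (2 * Real.pi)) * (∫ y, Real.log ‖x - y‖ * φ y ^ 2) * φ x = 0)
    (hN : Integrable (fun x => φ x ^ 2))
    (hΛ : (∫ x, φ x ^ 2) = Λ₀)
    (hT : Integrable (fun x => ‖fderiv ℝ φ x‖ ^ 2))
    (hX : Integrable (fun x => Real.log (1 + ‖x‖) * φ x ^ 2))
    (hV : Integrable (fun p : EuclideanSpace ℝ (Fin 2) × EuclideanSpace ℝ (Fin 2) =>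
      Real.log ‖p.1 - p.2‖ * φ p.1 ^ 2 * φ p.2 ^ 2))
    (hdecay : Integrable (fun x => ‖x‖ * ‖fderiv ℝ φ x‖ * |φ x|)) :
    (∫ x, ‖fderiv ℝ φ x‖ ^ 2) = Λ₀ ^ 2 / (8 * Real.pi) ∧
    (1 / (2 * Real.pi)) *
        (∫ p : EuclideanSpace ℝ (Fin 2) × EuclideanSpace ℝ (Fin 2),
          Real.log ‖p.1 - p.2‖ * φ p.1 ^ 2 * φ p.2 ^ 2)
      = -(∫ x, ‖fderiv ℝ φ x‖ ^ 2) ∧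
    (∫ x, ‖fderiv ℝ φ x‖ ^ 2) + (1 / 2) * ((1 / (2 * Real.pi)) *
        ∫ p : EuclideanSpace ℝ (Fin 2) × EuclideanSpace ℝ (Fin 2),
          Real.log ‖p.1 - p.2‖ * φ p.1 ^ 2 * φ p.2 ^ 2)
      = Λ₀ ^ 2 / (16 * Real.pi) := by
  have hpde' : ∀ x, laplacian φ x
      = (1 / (2 * Real.pi)) * (∫ y, Real.log ‖x - y‖ * φ y ^ 2) * φ x := fun x => by
    linarith [hpde x]
  have h1 := potential_eq_neg_kinetic hreg hpde' hN hT hV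
  have h2 := integral_log_eq hreg hpde' hN hT hX hV
  have hTv : (∫ x, ‖fderiv ℝ φ x‖ ^ 2) = Λ₀ ^ 2 / (8 * Real.pi) := by
    rw [← neg_eq_iff_eq_neg] at h1
    rw [← h1, h2, hΛ]
    field_simp
    ring
  refine ⟨hTv, h1, ?_⟩
  rw [h1, hTv]
  field_simp
  ring
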